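/- Fix an integer I ≥ 2 and let Φ be the equilibrium equation function. Then Φ(0) = 1 − 1/I > 0, and there exists α* > 0 such that Φ(α*) = 0. -/

import Mathlib

open MeasureTheory ProbabilityTheory Matrix Filter

noncomputable section

/-- The standard Gaussian measure `γ_I` on `ℝ^I` (mean 0, identity covariance). -/
def stdGaussian (I : ℕ) : Measure (Fin I → ℝ) :=
  Measure.pi fun _ => gaussianReal 0 1

/-- The matrix `Q = Id − (1/I)·𝟙𝟙ᵀ`. -/
def Qmat (I : ℕ) : Matrix (Fin I) (Fin I) ℝ :=
  1 - (I : ℝ)⁻¹ • Matrix.of fun _ _ => (1 : ℝ)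

/-- The posterior map `p(·; D̂)`:
`p_j(ω; D̂) = exp(⟨d̂⁽ʲ⁾, ω⟩ − ½‖d̂⁽ʲ⁾‖²) / Σ_k exp(⟨d̂⁽ᵏ⁾, ω⟩ − ½‖d̂⁽ᵏ⁾‖²)`,
where `d̂⁽ʲ⁾ = D̂ e_j` is the `j`-th column of `D̂`. -/
def postMap (I : ℕ) (D : Matrix (Fin I) (Fin I) ℝ) (ω : Fin I → ℝ) : Fin I → ℝ :=
  fun j => Real.exp ((∑ k, D k j * ω k) - (∑ k, (D k j) ^ 2) / 2) /
    ∑ l, Real.exp ((∑ k, D k l * ω k) - (∑ k, (D k l) ^ 2) / 2)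

/-- `π̄(d; D̂) = ∫ p(d + x; D̂) dγ_I(x)`. -/
def postBar (I : ℕ) (D : Matrix (Fin I) (Fin I) ℝ) (d : Fin I → ℝ) : Fin I → ℝ :=
  fun j => ∫ x, postMap I D (d + x) j ∂(stdGaussian I)

/-- The insider's canonical objective `J(d; D̂, i) = ⟨e_i, d⟩ − ⟨π̄(d; D̂), d⟩`. -/
def Jobj (I : ℕ) (D : Matrix (Fin I) (Fin I) ℝ) (i : Fin I) (d : Fin I → ℝ) : ℝ :=
  d i - ∑ j, postBar I D d j * d j

/-- `D*` is an equilibrium of the canonical game if for every signal `i` the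
`i`-th column `D* e_i` globally maximizes `d ↦ J(d; D*, i)` over `ℝ^I`. -/
def IsEquilibrium (I : ℕ) (D : Matrix (Fin I) (Fin I) ℝ) : Prop :=
  ∀ i : Fin I, ∀ d : Fin I → ℝ, Jobj I D i d ≤ Jobj I D i (fun k => D k i)

/-- `softmax(v)_j = e^{v_j} / Σ_k e^{v_k}`. -/
def softmax {I : ℕ} (v : Fin I → ℝ) : Fin I → ℝ :=
  fun j => Real.exp (v j) / ∑ k, Real.exp (v k)

/-- The law of the centered Gaussian vector `Z_α` on `ℝ^I` with covariance matrix `α²Q`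
(realized as `α·Q·x` with `x` standard Gaussian; since `Q` is a symmetric projection,
the covariance of `α·Q·x` is `α²Q`; for `α = 0` this is the point mass at `0`). -/
def lawZ (I : ℕ) (α : ℝ) : Measure (Fin I → ℝ) :=
  (stdGaussian I).map fun x => α • (Qmat I).mulVec x

/-- The equilibrium equation function `Φ(α) = E[(1 − α²p₁)(1 − p₁)]`, where
`p = softmax(α²e₁ + Z_α)` and `Z_α` is centered Gaussian with covariance `α²Q`. -/
def Phi (I : ℕ) [NeZero I] (α : ℝ) : ℝ :=
  ∫ z : Fin I → ℝ,
    (1 - α ^ 2 * softmax (α ^ 2 • (Pi.single (0 : Fin I) 1 : Fin I → ℝ) + z) 0) *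
      (1 - softmax (α ^ 2 • (Pi.single (0 : Fin I) 1 : Fin I → ℝ) + z) 0) ∂(lawZ I α)

instance instIsProbabilityMeasureStdGaussian (I : ℕ) :
    IsProbabilityMeasure (_root_.stdGaussian I) := by
  unfold _root_.stdGaussian
  infer_instance

theorem Qmat_mulVec_apply (I : ℕ) (x : Fin I → ℝ) (i : Fin I) :
    (Qmat I).mulVec x i = x i - (I : ℝ)⁻¹ * ∑ k, x k := by
  rw [Qmat, Matrix.sub_mulVec, Matrix.smul_mulVec, Matrix.one_mulVec]
  simp [Matrix.mulVec, dotProduct]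

section Softmax

variable {I : ℕ}

theorem softmax_add_const (v : Fin I → ℝ) (c : ℝ) :
    softmax (fun j => v j + c) = softmax v := by
  funext j
  simp only [softmax, Real.exp_add, ← Finset.sum_mul]
  exact mul_div_mul_right _ _ (Real.exp_pos c).ne'

theorem softmax_comp_equiv (e : Fin I ≃ Fin I) (v : Fin I → ℝ) (j : Fin I) :
    softmax (fun k => v (e k)) j = softmax v (e j) := by
  simp only [softmax]
  rw [Equiv.sum_comp e fun k => Real.exp (v k)]

theorem softmax_nonneg (v : Fin I → ℝ) (j : Fin I) : 0 ≤ softmax v j := by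
  unfold softmax
  positivity

theorem sum_exp_pos [NeZero I] (v : Fin I → ℝ) : 0 < ∑ k, Real.exp (v k) :=
  Finset.sum_pos (fun _ _ => Real.exp_pos _) Finset.univ_nonempty

theorem exp_eq_softmax_mul [NeZero I] (v : Fin I → ℝ) (j : Fin I) :
    Real.exp (v j) = softmax v j * ∑ k, Real.exp (v k) :=
  (div_mul_cancel₀ _ (sum_exp_pos v).ne').symm

theorem sum_softmax [NeZero I] (v : Fin I → ℝ) : ∑ j, softmax v j = 1 := by
  simp only [softmax, ← Finset.sum_div]
  exact div_self (sum_exp_pos v).ne'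

theorem softmax_le_one [NeZero I] (v : Fin I → ℝ) (j : Fin I) : softmax v j ≤ 1 :=
  sum_softmax v ▸ Finset.single_le_sum (fun k _ => softmax_nonneg v k) (Finset.mem_univ j)

theorem continuous_softmax [NeZero I] (j : Fin I) :
    Continuous fun v : Fin I → ℝ => softmax v j := by
  unfold softmax
  exact Continuous.div (by fun_prop) (by fun_prop) fun v => (sum_exp_pos v).ne'

end Softmax

section Gaussian

theorem pi_withDensity_eq {ι : Type*} [Fintype ι] {X : ι → Type*} [∀ i, MeasurableSpace (X i)]
    (μ : ∀ i, Measure (X i)) [∀ i, IsProbabilityMeasure (μ i)] (f : ∀ i, X i → ENNReal)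
    (hf : ∀ i, Measurable (f i)) [∀ i, SigmaFinite ((μ i).withDensity (f i))] :
    Measure.pi (fun i => (μ i).withDensity (f i)) =
      (Measure.pi μ).withDensity fun x => ∏ i, f i (x i) := by
  refine Measure.pi_eq fun s hs => ?_
  have hbox : ∀ x : ∀ i, X i, (Set.univ.pi s).indicator (fun x => ∏ i, f i (x i)) x =
      ∏ i, (s i).indicator (f i) (x i) := by
    intro x
    by_cases hx : x ∈ Set.univ.pi s
    · rw [Set.indicator_of_mem hx]
      exact Finset.prod_congr rfl fun i _ =>
        (Set.indicator_of_mem (hx i (Set.mem_univ i)) _).symm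
    · rw [Set.indicator_of_notMem hx]
      simp only [Set.mem_pi, Set.mem_univ, true_implies, not_forall] at hx
      obtain ⟨i, hi⟩ := hx
      exact (Finset.prod_eq_zero (Finset.mem_univ i) (Set.indicator_of_notMem hi _)).symm
  rw [withDensity_apply _ (MeasurableSet.univ_pi hs),
    ← lintegral_indicator (MeasurableSet.univ_pi hs)]
  simp_rw [hbox]
  have hm : ∀ i, Measurable ((s i).indicator (f i)) := fun i => (hf i).indicator (hs i)
  rw [lintegral_prod_eq_prod_lintegral_of_indepFun Finset.univ
    (fun i (x : ∀ i, X i) => (s i).indicator (f i) (x i))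
    (iIndepFun_pi fun i => (hm i).aemeasurable) fun i => (hm i).comp (measurable_pi_apply i)]
  refine Finset.prod_congr rfl fun i _ => ?_
  rw [withDensity_apply _ (hs i), ← lintegral_indicator (hs i),
    (measurePreserving_eval μ i).lintegral_comp (hm i)]

theorem gaussianReal_eq_withDensity_exp (c : ℝ) :
    gaussianReal c 1 =
      (gaussianReal 0 1).withDensity fun x => ENNReal.ofReal (Real.exp (c * x - c ^ 2 / 2)) := by
  rw [gaussianReal_of_var_ne_zero _ one_ne_zero, gaussianReal_of_var_ne_zero _ one_ne_zero,
    ← withDensity_mul _ (measurable_gaussianPDF 0 1) (by fun_prop)]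
  congr 1
  funext x
  simp only [Pi.mul_apply, gaussianPDF, gaussianPDFReal]
  rw [← ENNReal.ofReal_mul (by positivity), mul_assoc _ (Real.exp _), ← Real.exp_add]
  congr 3
  push_cast
  ring

/-- The Cameron–Martin formula for the standard Gaussian measure. -/
theorem integral_stdGaussian_add (I : ℕ) (c : Fin I → ℝ) {g : (Fin I → ℝ) → ℝ}
    (hg : Continuous g) :
    ∫ x, g (x + c) ∂(_root_.stdGaussian I) =
      ∫ x, (∏ i, Real.exp (c i * x i - c i ^ 2 / 2)) * g x ∂(_root_.stdGaussian I) := by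
  have hmap : (_root_.stdGaussian I).map (fun x => x + c) =
      (_root_.stdGaussian I).withDensity
        fun x => ∏ i, ENNReal.ofReal (Real.exp (c i * x i - c i ^ 2 / 2)) := by
    have hshift : (_root_.stdGaussian I).map (fun x => x + c) =
        Measure.pi fun i => gaussianReal (c i) 1 := by
      have h := Measure.pi_map_pi (μ := fun _ : Fin I => gaussianReal 0 1)
        (f := fun i x => x + c i) fun i => by fun_prop
      simp only [gaussianReal_map_add_const, zero_add] at h
      exact h
    have : ∀ i, SigmaFinite ((gaussianReal 0 1).withDensity
        fun x => ENNReal.ofReal (Real.exp (c i * x - c i ^ 2 / 2))) := fun i => by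
      rw [← gaussianReal_eq_withDensity_exp]
      infer_instance
    rw [hshift, show (fun i => gaussianReal (c i) 1) = _ from
      funext fun i => gaussianReal_eq_withDensity_exp (c i)]
    exact pi_withDensity_eq _ _ fun i => by fun_prop
  rw [← integral_map (f := g) (by fun_prop) hg.aestronglyMeasurable, hmap,
    integral_withDensity_eq_integral_toReal_smul (by fun_prop)
      (ae_of_all _ fun x => ENNReal.prod_lt_top fun i _ => ENNReal.ofReal_lt_top)]
  simp only [ENNReal.toReal_prod, ENNReal.toReal_ofReal (Real.exp_pos _).le, smul_eq_mul]

theorem integral_stdGaussian_comp_equiv (I : ℕ) (e : Fin I ≃ Fin I) (g : (Fin I → ℝ) → ℝ) :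
    ∫ x, g (fun k => x (e k)) ∂(_root_.stdGaussian I) = ∫ x, g x ∂(_root_.stdGaussian I) :=
  ((measurePreserving_piCongrLeft (fun _ : Fin I => gaussianReal 0 1) e).symm).integral_comp' g

theorem integrable_exp_mul_stdGaussian (I : ℕ) (α : ℝ) (j : Fin I) :
    Integrable (fun x => Real.exp (α * x j)) (_root_.stdGaussian I) :=
  (measurePreserving_eval (fun _ : Fin I => gaussianReal 0 1) j).integrable_comp_of_integrable
    (integrable_exp_mul_gaussianReal α)

end Gaussian

section Phi

/-- The integrand of `Phi`, as a function of `a = α²` and the first posterior probability. -/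
def phiIntegrand (a p : ℝ) : ℝ := (1 - a * p) * (1 - p)

theorem abs_phiIntegrand_le {a p : ℝ} (ha : 0 ≤ a) (hp : 0 ≤ p) (hp1 : p ≤ 1) :
    |phiIntegrand a p| ≤ 1 + a := by
  have h1 : |1 - a * p| ≤ 1 + a := by
    rw [abs_le]
    constructor <;> nlinarith [mul_nonneg ha hp, mul_le_mul_of_nonneg_left hp1 ha]
  have h2 : |1 - p| ≤ 1 := by
    rw [abs_le]
    constructor <;> linarith
  rw [phiIntegrand, abs_mul]
  nlinarith [abs_nonneg (1 - a * p), abs_nonneg (1 - p)]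

theorem sum_mul_phiIntegrand_nonpos {I : ℕ} [NeZero I] {p : Fin I → ℝ} (hp : ∀ j, 0 ≤ p j)
    (hsum : ∑ j, p j = 1) {a : ℝ} (ha : 2 * (I : ℝ) ^ 2 ≤ a) :
    ∑ j, p j * phiIntegrand a (p j) ≤ 0 := by
  have hI : (0 : ℝ) < I := Nat.cast_pos.2 (NeZero.pos I)
  have hle : ∀ j, p j ≤ 1 := fun j =>
    hsum ▸ Finset.single_le_sum (fun k _ => hp k) (Finset.mem_univ j)
  obtain ⟨m, hm⟩ : ∃ m, 1 / (I : ℝ) ≤ p m := by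
    by_contra! h
    have := Finset.sum_lt_sum_of_nonempty Finset.univ_nonempty fun i (_ : i ∈ Finset.univ) => h i
    simp [hsum, hI.ne'] at this
  have hm' : 1 ≤ I * p m := by
    rwa [div_le_iff₀' hI] at hm
  have hsq : p m ^ 2 ≤ ∑ j, p j ^ 2 :=
    Finset.single_le_sum (f := fun j => p j ^ 2) (fun k _ => sq_nonneg _) (Finset.mem_univ m)
  have hcub : p m ^ 2 * (1 - p m) ≤ ∑ j, p j ^ 2 * (1 - p j) :=
    Finset.single_le_sum (f := fun j => p j ^ 2 * (1 - p j))
      (fun k _ => mul_nonneg (sq_nonneg _) (sub_nonneg.2 (hle k))) (Finset.mem_univ m)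
  have ha0 : 0 ≤ a := le_trans (by positivity) ha
  have hexp : ∑ j, p j * phiIntegrand a (p j) =
      ∑ j, p j - ∑ j, p j ^ 2 - a * ∑ j, p j ^ 2 * (1 - p j) := by
    rw [Finset.mul_sum, ← Finset.sum_sub_distrib, ← Finset.sum_sub_distrib]
    refine Finset.sum_congr rfl fun j _ => ?_
    rw [phiIntegrand]
    ring
  have hbig : 2 ≤ a * p m ^ 2 := by
    nlinarith [mul_le_mul_of_nonneg_right ha (sq_nonneg (p m))]
  rw [hexp, hsum]
  nlinarith [mul_le_mul_of_nonneg_left hcub ha0,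
    mul_le_mul_of_nonneg_right hbig (sub_nonneg.2 (hle m)), hle m, hp m]

variable (I : ℕ) [NeZero I] (α : ℝ)

theorem Phi_eq_integral_stdGaussian :
    Phi I α = ∫ x, phiIntegrand (α ^ 2)
      (softmax (α • (x + α • (Pi.single (0 : Fin I) 1 : Fin I → ℝ))) 0)
        ∂(_root_.stdGaussian I) := by
  have hs := continuous_softmax (0 : Fin I)
  have hQ : Measurable fun x : Fin I → ℝ => α • (Qmat I).mulVec x :=
    (Continuous.const_smul (Continuous.matrix_mulVec continuous_const continuous_id) α).measurable
  have hcont : Continuous fun z : Fin I → ℝ =>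
      softmax (α ^ 2 • (Pi.single (0 : Fin I) 1 : Fin I → ℝ) + z) 0 :=
    hs.comp (by fun_prop)
  rw [Phi, lawZ, integral_map hQ.aemeasurable
    (Continuous.aestronglyMeasurable (by fun_prop))]
  refine integral_congr_ae (ae_of_all _ fun x => ?_)
  have hx : softmax (α ^ 2 • (Pi.single (0 : Fin I) 1 : Fin I → ℝ) + α • (Qmat I).mulVec x) =
      softmax (α • (x + α • (Pi.single (0 : Fin I) 1 : Fin I → ℝ))) := by
    rw [← softmax_add_const (α • (x + α • (Pi.single (0 : Fin I) 1 : Fin I → ℝ)))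
      (-(α * ((I : ℝ)⁻¹ * ∑ k, x k)))]
    congr 1
    funext j
    simp only [Pi.add_apply, Pi.smul_apply, smul_eq_mul, Qmat_mulVec_apply]
    ring
  simp only [hx, phiIntegrand]

theorem Phi_eq_integral_exp_mul (j : Fin I) :
    Phi I α = Real.exp (-(α ^ 2 / 2)) * ∫ x, Real.exp (α * x j) *
      phiIntegrand (α ^ 2) (softmax (α • x) j) ∂(_root_.stdGaussian I) := by
  have hcont : Continuous fun x : Fin I → ℝ =>
      phiIntegrand (α ^ 2) (softmax (α • x) 0) := by
    have : Continuous fun x : Fin I → ℝ => softmax (α • x) 0 :=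
      (continuous_softmax (0 : Fin I)).comp (by fun_prop)
    unfold phiIntegrand
    fun_prop
  rw [Phi_eq_integral_stdGaussian, integral_stdGaussian_add I _ hcont, ← integral_const_mul,
    ← integral_stdGaussian_comp_equiv I (Equiv.swap 0 j)]
  refine integral_congr_ae (ae_of_all _ fun x => ?_)
  have hsm : softmax (α • fun k => x (Equiv.swap 0 j k)) 0 = softmax (α • x) j := by
    have h := softmax_comp_equiv (Equiv.swap 0 j) (α • x) 0
    rwa [Equiv.swap_apply_left] at h
  have hprod : ∏ i, Real.exp ((α • (Pi.single (0 : Fin I) 1 : Fin I → ℝ)) i *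
      x (Equiv.swap 0 j i) - (α • (Pi.single (0 : Fin I) 1 : Fin I → ℝ)) i ^ 2 / 2) =
      Real.exp (-(α ^ 2 / 2)) * Real.exp (α * x j) := by
    rw [Finset.prod_eq_single 0 (fun i _ hi => by simp [hi]) (by simp), ← Real.exp_add]
    simp only [Pi.smul_apply, Pi.single_eq_same, smul_eq_mul, mul_one, Equiv.swap_apply_left]
    ring_nf
  simp only [hsm, hprod, mul_assoc]

theorem Phi_nonpos {α : ℝ} (hα : 2 * (I : ℝ) ^ 2 ≤ α ^ 2) : Phi I α ≤ 0 := by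
  have hI : (0 : ℝ) < I := Nat.cast_pos.2 (NeZero.pos I)
  have hint : ∀ j : Fin I, Integrable (fun x => Real.exp (α * x j) *
      phiIntegrand (α ^ 2) (softmax (α • x) j)) (_root_.stdGaussian I) := by
    intro j
    have hcont : Continuous fun x : Fin I → ℝ => softmax (α • x) j :=
      (continuous_softmax j).comp (by fun_prop)
    refine (integrable_exp_mul_stdGaussian I α j).mul_bdd (c := 1 + α ^ 2) ?_
      (ae_of_all _ fun x => abs_phiIntegrand_le (sq_nonneg α) (softmax_nonneg _ _)
        (softmax_le_one _ _))
    unfold phiIntegrand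
    exact Continuous.aestronglyMeasurable (by fun_prop)
  have hsum : (I : ℝ) * Phi I α = Real.exp (-(α ^ 2 / 2)) * ∫ x, ∑ j, Real.exp (α * x j) *
      phiIntegrand (α ^ 2) (softmax (α • x) j) ∂(_root_.stdGaussian I) := by
    rw [integral_finsetSum _ fun j _ => hint j, Finset.mul_sum,
      ← Finset.sum_congr rfl fun j _ => Phi_eq_integral_exp_mul I α j]
    simp
  have hpt : ∀ x : Fin I → ℝ, ∑ j, Real.exp (α * x j) *
      phiIntegrand (α ^ 2) (softmax (α • x) j) ≤ 0 := by
    intro x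
    have h : ∀ j, Real.exp (α * x j) * phiIntegrand (α ^ 2) (softmax (α • x) j) =
        (∑ k, Real.exp ((α • x) k)) *
          (softmax (α • x) j * phiIntegrand (α ^ 2) (softmax (α • x) j)) := fun j => by
      rw [show α * x j = (α • x) j from rfl, exp_eq_softmax_mul]
      ring
    simp only [h, ← Finset.mul_sum]
    exact mul_nonpos_of_nonneg_of_nonpos (sum_exp_pos _).le
      (sum_mul_phiIntegrand_nonpos (softmax_nonneg _) (sum_softmax _) hα)
  have hle : (I : ℝ) * Phi I α ≤ 0 :=
    hsum ▸ mul_nonpos_of_nonneg_of_nonpos (Real.exp_pos _).le (integral_nonpos hpt)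
  exact nonpos_of_mul_nonpos_right hle hI

theorem continuousOn_Phi (b : ℝ) : ContinuousOn (Phi I) (Set.Icc 0 b) := by
  have hcont : Continuous fun q : ℝ × (Fin I → ℝ) => phiIntegrand (q.1 ^ 2)
      (softmax (q.1 • (q.2 + q.1 • (Pi.single (0 : Fin I) 1 : Fin I → ℝ))) 0) := by
    have : Continuous fun q : ℝ × (Fin I → ℝ) =>
        softmax (q.1 • (q.2 + q.1 • (Pi.single (0 : Fin I) 1 : Fin I → ℝ))) 0 :=
      (continuous_softmax (0 : Fin I)).comp (by fun_prop)
    unfold phiIntegrand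
    fun_prop
  rw [show Phi I = _ from funext fun α => Phi_eq_integral_stdGaussian I α]
  refine continuousOn_of_dominated (bound := fun _ => 1 + b ^ 2) (fun α _ => ?_)
    (fun α hα => ae_of_all _ fun x => ?_) (integrable_const _) (ae_of_all _ fun x => ?_)
  · exact (hcont.comp (Continuous.prodMk_right α)).aestronglyMeasurable
  · refine (abs_phiIntegrand_le (sq_nonneg α) (softmax_nonneg _ _) (softmax_le_one _ _)).trans ?_
    gcongr
    exacts [hα.1, hα.2]
  · exact (hcont.comp (Continuous.prodMk_left x)).continuousOn

theorem Phi_zero : Phi I 0 = 1 - 1 / (I : ℝ) := by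
  simp [Phi_eq_integral_stdGaussian, phiIntegrand, softmax]

end Phi

/-- `Φ(0) = 1 − 1/I > 0`, and there exists `α* > 0` such that `Φ(α*) = 0`. -/
theorem Phi_at_zero_and_exists_root (I : ℕ) [NeZero I] (hI : 2 ≤ I) :
    Phi I 0 = 1 - 1 / (I : ℝ) ∧ (0 : ℝ) < 1 - 1 / (I : ℝ) ∧
      ∃ αStar : ℝ, 0 < αStar ∧ Phi I αStar = 0 := by
  have hI' : (2 : ℝ) ≤ I := by exact_mod_cast hI
  have hpos : (0 : ℝ) < 1 - 1 / (I : ℝ) := by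
    rw [sub_pos, div_lt_one (by linarith)]
    linarith
  refine ⟨Phi_zero I, hpos, ?_⟩
  obtain ⟨α, hα, hroot⟩ := intermediate_value_Icc' (by positivity : (0 : ℝ) ≤ 2 * I)
    (continuousOn_Phi I (2 * I))
    ⟨Phi_nonpos I (by nlinarith [sq_nonneg (I : ℝ)]), (Phi_zero I).symm ▸ hpos.le⟩
  refine ⟨α, lt_of_le_of_ne hα.1 fun h => ?_, hroot⟩
  rw [← h, Phi_zero] at hroot
  exact hpos.ne' hroot

end
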